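/- arXiv:1306.5721 — 3 statements merged into one kernel-verified Lean document; each statement's English description precedes it below -/
import Mathlib

section
/- Let b > a ≥ 0, α ≥ 0, β > 0, R > 0, 1 ≤ p < ∞ and M_a, M_b > 0. Suppose F : B^a_ℂ(R) → ℓ^{p,α+βa}_ℂ is analytic with ‖F(φ)‖_{p,α+βa} ≤ M_a for every φ ∈ B^a_ℂ(R), and suppose that sup_{φ ∈ B^b_ℂ(R)} ‖F(φ)‖_{p,α+βb} ≤ M_b. Then for every λ ∈ [0,1] and s = (1−λ)a + λb, F maps B^s_ℂ(R) into ℓ^{p,α+βs}_ℂ, the restriction F|_{B^s_ℂ(R)} : B^s_ℂ(R) → ℓ^{p,α+βs}_ℂ is analytic, and ‖F(φ)‖_{p,α+βs} ≤ (M_a)^{1−λ}(M_b)^{λ} for every φ ∈ B^s_ℂ(R). -/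
open scoped ENNReal

/-- The weight `⟨k⟩ = 1 + |k|`. -/
noncomputable def wt (k : ℤ) : ℝ := 1 + |(k : ℝ)|

/-- `φ ∈ H^s`: the weighted square sum of Fourier coefficients is finite. -/
def memH (s : ℝ) (φ : ℤ → ℂ) : Prop :=
  Summable fun k : ℤ => (wt k ^ s * ‖φ k‖) ^ 2

/-- The `H^s` norm of a sequence of Fourier coefficients. -/
noncomputable def hNorm (s : ℝ) (φ : ℤ → ℂ) : ℝ :=
  (∑' k : ℤ, (wt k ^ s * ‖φ k‖) ^ 2) ^ ((1:ℝ)/2)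

/-- `ξ ∈ ℓ^{p,t}`. -/
def memL (p t : ℝ) (ξ : ℤ → ℂ) : Prop :=
  Summable fun k : ℤ => (wt k ^ t * ‖ξ k‖) ^ p

/-- The `ℓ^{p,t}` norm. -/
noncomputable def lNorm (p t : ℝ) (ξ : ℤ → ℂ) : ℝ :=
  (∑' k : ℤ, (wt k ^ t * ‖ξ k‖) ^ p) ^ (1/p)

/-- `F`, given in terms of Fourier coefficients, is an analytic (holomorphic, i.e. complex
Fréchet differentiable) map from the ball `B^s_ℂ(R) ⊆ H^s_ℂ` to `ℓ^{p,t}_ℂ`: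
under the isometric identifications `H^s_ℂ ≅ ℓ²` (via `φ ↦ (⟨k⟩^s φ̂(k))_k`) and
`ℓ^{p,t}_ℂ ≅ ℓ^p` (via `ξ ↦ (⟨k⟩^t ξ_k)_k`), there is a map `G` on the ball of radius `R`
of `ℓ²`, complex differentiable on it, which represents `F`. -/
def IsAnalyticOnBall (P : ℝ≥0∞) [Fact (1 ≤ P)] (s t R : ℝ)
    (F : (ℤ → ℂ) → (ℤ → ℂ)) : Prop :=
  ∃ G : lp (fun _ : ℤ => ℂ) 2 → lp (fun _ : ℤ => ℂ) P,
    DifferentiableOn ℂ G (Metric.ball 0 R) ∧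
    ∀ x ∈ Metric.ball (0 : lp (fun _ : ℤ => ℂ) 2) R, ∀ k : ℤ,
      (G x : ℤ → ℂ) k = ((wt k ^ t : ℝ) : ℂ) *
        F (fun j => ((wt j ^ (-s) : ℝ) : ℂ) * (x : ℤ → ℂ) j) k

section Truncation

variable {ι : Type*} {P : ℝ≥0∞} [Fact (1 ≤ P)]

theorem ENNReal.toReal_pos_of_fact (hP : P ≠ ∞) : 0 < P.toReal :=
  ENNReal.toReal_pos (zero_lt_one.trans_le (Fact.out : 1 ≤ P)).ne' hP

theorem lp.norm_sum_single_mono [DecidableEq ι] (hP : P ≠ ∞) {u v : ι → ℂ} (K : Finset ι)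
    (h : ∀ k ∈ K, ‖u k‖ ≤ ‖v k‖) :
    ‖∑ k ∈ K, lp.single (E := fun _ : ι => ℂ) P k (u k)‖ ≤
      ‖∑ k ∈ K, lp.single (E := fun _ : ι => ℂ) P k (v k)‖ := by
  have hp := ENNReal.toReal_pos_of_fact hP
  rw [← Real.rpow_le_rpow_iff (norm_nonneg _) (norm_nonneg _) hp,
    lp.norm_sum_single hp, lp.norm_sum_single hp]
  gcongr with k hk
  exact h k hk

theorem lp.norm_sum_single_le [DecidableEq ι] (hP : P ≠ ∞) (f : lp (fun _ : ι => ℂ) P)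
    (K : Finset ι) :
    ‖∑ k ∈ K, lp.single (E := fun _ : ι => ℂ) P k (f k)‖ ≤ ‖f‖ := by
  have hp := ENNReal.toReal_pos_of_fact hP
  rw [← Real.rpow_le_rpow_iff (norm_nonneg _) (norm_nonneg _) hp, lp.norm_sum_single hp]
  exact lp.sum_rpow_le_norm_rpow hp f K

/-- A sequence whose finite truncations are bounded by `C` in `ℓ^p` is in `ℓ^p`, with norm at
most `C`. -/
theorem lp.exists_of_norm_sum_single_le [DecidableEq ι] (hP : P ≠ ∞) {u : ι → ℂ}
    {C : ℝ}
    (h : ∀ K : Finset ι, ‖∑ k ∈ K, lp.single (E := fun _ : ι => ℂ) P k (u k)‖ ≤ C) :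
    ∃ f : lp (fun _ : ι => ℂ) P, (∀ k, f k = u k) ∧ ‖f‖ ≤ C := by
  have hp := ENNReal.toReal_pos_of_fact hP
  have hC : 0 ≤ C := (norm_nonneg _).trans (h ∅)
  have hsum : ∀ K : Finset ι, ∑ k ∈ K, ‖u k‖ ^ P.toReal ≤ C ^ P.toReal := fun K => by
    rw [← lp.norm_sum_single hp]
    exact Real.rpow_le_rpow (norm_nonneg _) (h K) hp.le
  exact ⟨⟨u, memℓp_gen' hsum⟩, fun _ => rfl, lp.norm_le_of_forall_sum_le hp hC hsum⟩

/-- Pointwise multiplication by a bounded sequence. -/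
theorem lp.exists_diagonal (m : ι → ℂ) (hm : ∀ j, ‖m j‖ ≤ 1) :
    ∃ D : lp (fun _ : ι => ℂ) P →L[ℂ] lp (fun _ : ι => ℂ) P,
      (∀ v j, D v j = m j * v j) ∧ ∀ v, ‖D v‖ ≤ ‖v‖ := by
  have hle : ∀ (v : ι → ℂ) j, ‖m j * v j‖ ≤ ‖v j‖ := fun v j => by
    rw [norm_mul]
    exact mul_le_of_le_one_left (norm_nonneg _) (hm j)
  let D : lp (fun _ : ι => ℂ) P →ₗ[ℂ] lp (fun _ : ι => ℂ) P :=
    { toFun := fun v => ⟨fun j => m j * v j, (lp.memℓp v).mono' (hle v)⟩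
      map_add' := fun v w => by ext j; exact mul_add _ _ _
      map_smul' := fun c v => by ext j; exact mul_left_comm _ _ _ }
  have hD : ∀ v, ‖D v‖ ≤ ‖v‖ := fun v =>
    lp.norm_mono (zero_lt_one.trans_le (Fact.out : 1 ≤ P)).ne' (hle v)
  exact ⟨D.mkContinuous 1 fun v => by simpa using hD v, fun _ _ => rfl, hD⟩

end Truncation

section Holomorphic

variable {E : Type*} [NormedAddCommGroup E] [NormedSpace ℂ E]

theorem Complex.norm_hasDerivAt_le {f : ℂ → E} {f' : E} {M ρ : ℝ} (hρ : 0 < ρ)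
    (hd : DifferentiableOn ℂ f (Metric.ball 0 ρ)) (hM : ∀ z ∈ Metric.ball (0 : ℂ) ρ, ‖f z‖ ≤ M)
    (hf' : HasDerivAt f f' 0) : ‖f'‖ ≤ 2 * M / ρ := by
  rw [← hf'.deriv]
  refine Complex.norm_deriv_le_div_of_mapsTo_ball hd (fun z hz => ?_) hρ
  rw [Metric.mem_closedBall, dist_eq_norm]
  linarith [norm_sub_le (f z) (f 0), hM z hz, hM 0 (Metric.mem_ball_self hρ)]

theorem Complex.norm_sub_sub_hasDerivAt_le {f : ℂ → E} {f' : E} {M ρ : ℝ} (hρ : 1 < ρ)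
    (hd : DifferentiableOn ℂ f (Metric.ball 0 ρ)) (hM : ∀ z ∈ Metric.ball (0 : ℂ) ρ, ‖f z‖ ≤ M)
    (hf' : HasDerivAt f f' 0) : ‖f 1 - f 0 - f'‖ ≤ 4 * M / ρ ^ 2 := by
  have hρ0 : 0 < ρ := one_pos.trans hρ
  have hnorm := Complex.norm_hasDerivAt_le hρ0 hd hM hf'
  have key := Complex.dist_le_mul_div_pow_of_mapsTo_ball_of_isLittleO (n := 1)
    (f := fun z : ℂ => f z - z • f') (c := 0) (z := 1) (R₁ := ρ) (R₂ := 4 * M)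
    (hd.sub (by fun_prop)) (fun z hz => ?_) ?_ (by simpa using hρ)
  · simp only [one_smul, zero_smul, sub_zero, dist_eq_norm, norm_one] at key
    calc ‖f 1 - f 0 - f'‖ = ‖f 1 - f' - f 0‖ := by congr 1; abel
      _ ≤ _ := key
      _ = 4 * M / ρ ^ 2 := by rw [div_pow, one_pow, mul_one_div]
  · have hz' : ‖z‖ < ρ := by simpa using hz
    have h1 : ‖z • f'‖ ≤ 2 * M := by
      rw [norm_smul]
      calc ‖z‖ * ‖f'‖ ≤ ρ * (2 * M / ρ) := by gcongr
        _ = 2 * M := by field_simp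
    rw [Metric.mem_closedBall, dist_eq_norm]
    simp only [zero_smul, sub_zero]
    linarith [norm_sub_le (f z - z • f') (f 0), norm_sub_le (f z) (z • f'), hM z hz,
      hM 0 (Metric.mem_ball_self hρ0)]
  · have := hf'.isLittleO
    simp only [sub_zero, zero_smul, pow_one] at this ⊢
    refine (this.norm_right).congr_left fun z => ?_
    abel

/-- A bounded map into `ℓ^p` whose coordinates are holomorphic is holomorphic. -/
theorem differentiableOn_lp_of_apply {ι : Type*} [DecidableEq ι] {P : ℝ≥0∞} [Fact (1 ≤ P)]
    (hP : P ≠ ∞) {U : Set E} (hU : IsOpen U) {f : E → lp (fun _ : ι => ℂ) P} {M : ℝ}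
    (hM : ∀ x ∈ U, ‖f x‖ ≤ M) (hf : ∀ k, DifferentiableOn ℂ (fun x => f x k) U) :
    DifferentiableOn ℂ f U := by
  intro x₀ hx₀
  obtain ⟨r, hr, hrU⟩ := Metric.isOpen_iff.1 hU x₀ hx₀
  have hM0 : 0 ≤ M := (norm_nonneg _).trans (hM x₀ hx₀)
  let T : Finset ι → (ι → ℂ) → lp (fun _ : ι => ℂ) P :=
    fun K u => ∑ k ∈ K, lp.single (E := fun _ : ι => ℂ) P k (u k)
  let d : E → ι → ℂ := fun h k => fderiv ℂ (fun x => f x k) x₀ h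
  have hmaps : ∀ h : E, h ≠ 0 → ∀ z ∈ Metric.ball (0 : ℂ) (r / ‖h‖), x₀ + z • h ∈ U := by
    intro h hh z hz
    apply hrU
    rw [Metric.mem_ball, dist_eq_norm, add_sub_cancel_left, norm_smul]
    rw [mem_ball_zero_iff, lt_div_iff₀ (norm_pos_iff.2 hh)] at hz
    exact hz
  have hdiff : ∀ (K : Finset ι) (h : E), h ≠ 0 →
      DifferentiableOn ℂ (fun z : ℂ => T K (f (x₀ + z • h))) (Metric.ball 0 (r / ‖h‖)) := by
    intro K h hh
    refine DifferentiableOn.fun_sum fun k _ => ?_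
    exact (lp.singleContinuousLinearMap ℂ (fun _ : ι => ℂ) P k).differentiable.comp_differentiableOn
      ((hf k).comp (by fun_prop) (hmaps h hh))
  have hbound : ∀ (K : Finset ι) (h : E), h ≠ 0 → ∀ z ∈ Metric.ball (0 : ℂ) (r / ‖h‖),
      ‖T K (f (x₀ + z • h))‖ ≤ M := fun K h hh z hz =>
    (lp.norm_sum_single_le hP _ K).trans (hM _ (hmaps h hh z hz))
  have hderiv : ∀ (K : Finset ι) (h : E),
      HasDerivAt (fun z : ℂ => T K (f (x₀ + z • h))) (T K (d h)) 0 := by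
    intro K h
    refine HasDerivAt.fun_sum fun k _ => ?_
    have h1 : HasDerivAt (fun z : ℂ => x₀ + z • h) h 0 := by
      simpa using ((hasDerivAt_id (0 : ℂ)).smul_const h).const_add x₀
    have h2 : HasFDerivAt (fun x => f x k) (fderiv ℂ (fun x => f x k) x₀) (x₀ + (0 : ℂ) • h) := by
      simpa using ((hf k).differentiableAt (hU.mem_nhds hx₀)).hasFDerivAt
    exact (lp.singleContinuousLinearMap ℂ (fun _ : ι => ℂ) P k).hasFDerivAt.comp_hasDerivAt 0
      (HasFDerivAt.comp_hasDerivAt (l := fun x => f x k) (f := fun z : ℂ => x₀ + z • h) 0 h2 h1)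
  have hlin : ∀ (K : Finset ι) (h : E), ‖T K (d h)‖ ≤ 2 * M / r * ‖h‖ := by
    intro K h
    rcases eq_or_ne h 0 with rfl | hh
    · simp [T, d]
    · have hh' := norm_pos_iff.2 hh
      refine (Complex.norm_hasDerivAt_le (div_pos hr hh') (hdiff K h hh) (hbound K h hh)
        (hderiv K h)).trans_eq ?_
      field_simp
  choose L hL hLnorm using fun h => lp.exists_of_norm_sum_single_le hP fun K => hlin K h
  let L' : E →L[ℂ] lp (fun _ : ι => ℂ) P := LinearMap.mkContinuous
    { toFun := L
      map_add' := fun x y => by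
        ext k
        simp [hL, d]
      map_smul' := fun c x => by
        ext k
        simp [hL, d] } (2 * M / r) hLnorm
  have hL' : ∀ h k, L' h k = d h k := hL
  have hrem : ∀ h : E, ‖h‖ < r → ‖f (x₀ + h) - f x₀ - L' h‖ ≤ 4 * M / r ^ 2 * ‖h‖ ^ 2 := by
    intro h hhr
    rcases eq_or_ne h 0 with rfl | hh
    · simp
    · have hh' := norm_pos_iff.2 hh
      obtain ⟨g, hg, hgn⟩ := lp.exists_of_norm_sum_single_le hP
        (u := fun k => (f (x₀ + h) - f x₀ - L' h) k) (C := 4 * M / r ^ 2 * ‖h‖ ^ 2) fun K => by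
          have := Complex.norm_sub_sub_hasDerivAt_le ((one_lt_div hh').2 hhr) (hdiff K h hh)
            (hbound K h hh) (hderiv K h)
          simp only [one_smul, zero_smul, add_zero] at this
          calc _ = ‖T K (f (x₀ + h)) - T K (f x₀) - T K (d h)‖ := by
                simp [T, hL']
            _ ≤ _ := this
            _ = _ := by field_simp
      have : g = f (x₀ + h) - f x₀ - L' h := lp.ext (funext hg)
      rwa [← this]
  have : HasFDerivAt f L' x₀ := by
    rw [hasFDerivAt_iff_isLittleO_nhds_zero]
    refine Asymptotics.IsBigO.trans_isLittleO (g := fun h : E => ‖h‖ ^ 2) ?_ ?_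
    · refine Asymptotics.IsBigO.of_bound (4 * M / r ^ 2) ?_
      filter_upwards [Metric.ball_mem_nhds (0 : E) hr] with h hh
      simpa using hrem h (by simpa using hh)
    · exact Asymptotics.isLittleO_norm_pow_id one_lt_two
  exact this.differentiableAt.differentiableWithinAt

end Holomorphic

section Interpolation

variable {P : ℝ≥0∞} [Fact (1 ≤ P)]

/-- The three lines theorem along `z ↦ w ^ (γ z) G (w ^ (-δ z) x)`, for a finitely supported
`x`. -/
theorem norm_interpolation_le_of_finite {ι : Type*} [DecidableEq ι]
    (hP : P ≠ ∞) {w : ι → ℝ} (hw : ∀ k, 1 ≤ w k)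
    {δ γ R Ma Mb lam : ℝ} (hδ : 0 ≤ δ) (hγ : 0 ≤ γ) (hlam0 : 0 ≤ lam) (hlam1 : lam ≤ 1)
    {G : lp (fun _ : ι => ℂ) 2 → lp (fun _ : ι => ℂ) P}
    (hG : DifferentiableOn ℂ G (Metric.ball 0 R))
    (hGa : ∀ y ∈ Metric.ball (0 : lp (fun _ : ι => ℂ) 2) R, ‖G y‖ ≤ Ma)
    (hGb : ∀ v ∈ Metric.ball (0 : lp (fun _ : ι => ℂ) 2) R, ∀ y : lp (fun _ : ι => ℂ) 2,
      (∀ j, y j = ((w j ^ (-δ) : ℝ) : ℂ) * v j) → ∀ K : Finset ι,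
      ‖∑ k ∈ K, lp.single (E := fun _ : ι => ℂ) P k (((w k ^ γ : ℝ) : ℂ) * G y k)‖ ≤ Mb)
    (x : ι → ℂ) (S K : Finset ι)
    (hx : ‖∑ j ∈ S, lp.single (E := fun _ : ι => ℂ) 2 j (x j)‖ < R) :
    ‖∑ k ∈ K, lp.single (E := fun _ : ι => ℂ) P k (((w k ^ (γ * lam) : ℝ) : ℂ) *
      G (∑ j ∈ S, lp.single (E := fun _ : ι => ℂ) 2 j
        (((w j ^ (-(δ * lam)) : ℝ) : ℂ) * x j)) k)‖ ≤ Ma ^ (1 - lam) * Mb ^ lam := by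
  have hw0 : ∀ k, 0 < w k := fun k => one_pos.trans_le (hw k)
  have hwc : ∀ k, (w k : ℂ) ≠ 0 := fun k => by exact_mod_cast (hw0 k).ne'
  have hcpow : ∀ k (t : ℝ), ((w k ^ t : ℝ) : ℂ) = (w k : ℂ) ^ (t : ℂ) := fun k t =>
    Complex.ofReal_cpow (hw0 k).le t
  have hnorm : ∀ k (z : ℂ), ‖(w k : ℂ) ^ z‖ = w k ^ z.re := fun k z =>
    Complex.norm_cpow_eq_rpow_re_of_pos (hw0 k) z
  let y : ℂ → lp (fun _ : ι => ℂ) 2 := fun z =>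
    ∑ j ∈ S, lp.single (E := fun _ : ι => ℂ) 2 j ((w j : ℂ) ^ (-(δ * z)) * x j)
  let g : ℂ → lp (fun _ : ι => ℂ) P := fun z =>
    ∑ k ∈ K, lp.single (E := fun _ : ι => ℂ) P k ((w k : ℂ) ^ (γ * z) * G (y z) k)
  have hy : Differentiable ℂ y := by
    refine Differentiable.fun_sum fun j _ => ?_
    refine (lp.singleContinuousLinearMap ℂ (fun _ : ι => ℂ) 2 j).differentiable.comp
      (Differentiable.mul_const (fun z => ?_) _)
    exact DifferentiableAt.const_cpow (by fun_prop) (Or.inl (hwc j))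
  have hyR : ∀ z : ℂ, 0 ≤ z.re → y z ∈ Metric.ball 0 R := fun z hz => by
    rw [mem_ball_zero_iff]
    refine (lp.norm_sum_single_mono ENNReal.ofNat_ne_top S fun j _ => ?_).trans_lt hx
    rw [norm_mul, hnorm]
    refine mul_le_of_le_one_left (norm_nonneg _) (Real.rpow_le_one_of_one_le_of_nonpos (hw j) ?_)
    simp only [Complex.neg_re, Complex.re_ofReal_mul]
    exact neg_nonpos.2 (by positivity)
  have hg : ∀ z : ℂ, 0 ≤ z.re → DifferentiableAt ℂ g z := fun z hz => by
    refine DifferentiableAt.fun_sum fun k _ => ?_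
    refine (lp.singleContinuousLinearMap ℂ (fun _ : ι => ℂ) P k).differentiableAt.comp z
      (DifferentiableAt.mul ?_ ?_)
    · exact DifferentiableAt.const_cpow (by fun_prop) (Or.inl (hwc k))
    · exact (lp.evalCLM ℂ (fun _ : ι => ℂ) P k).differentiableAt.comp z
        ((hG.differentiableAt (Metric.isOpen_ball.mem_nhds (hyR z hz))).comp z (hy z))
  have hsub : closure (Complex.HadamardThreeLines.verticalStrip 0 1) ⊆ {z : ℂ | 0 ≤ z.re} :=
    closure_minimal (fun z hz => hz.1.le) (isClosed_le continuous_const Complex.continuous_re)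
  have hdiff : DiffContOnCl ℂ g (Complex.HadamardThreeLines.verticalStrip 0 1) :=
    DifferentiableOn.diffContOnCl fun z hz => (hg z (hsub hz)).differentiableWithinAt
  have hbdd : BddAbove ((norm ∘ g) '' Complex.HadamardThreeLines.verticalClosedStrip 0 1) := by
    refine ⟨∑ k ∈ K, w k ^ γ * Ma, ?_⟩
    rintro _ ⟨z, hz, rfl⟩
    refine (norm_sum_le _ _).trans (Finset.sum_le_sum fun k _ => ?_)
    have hP0 : 0 < P := zero_lt_one.trans_le (Fact.out : 1 ≤ P)
    rw [lp.norm_single hP0, norm_mul, hnorm]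
    refine mul_le_mul (Real.rpow_le_rpow_of_exponent_le (hw k) ?_)
      ((lp.norm_apply_le_norm hP0.ne' _ k).trans (hGa _ (hyR z hz.1))) (norm_nonneg _)
      (Real.rpow_nonneg (hw0 k).le _)
    rw [Complex.re_ofReal_mul]
    exact mul_le_of_le_one_right hγ hz.2
  have hleft : ∀ z ∈ Complex.re ⁻¹' {0}, ‖g z‖ ≤ Ma := fun z hz => by
    have hz0 : z.re = 0 := hz
    refine (lp.norm_sum_single_mono hP K fun k _ => ?_).trans
      ((lp.norm_sum_single_le hP (G (y z)) K).trans (hGa _ (hyR z hz0.ge)))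
    simp [hnorm, hz0]
  have hright : ∀ z ∈ Complex.re ⁻¹' {1}, ‖g z‖ ≤ Mb := fun z hz => by
    have hz1 : z.re = 1 := hz
    let v : lp (fun _ : ι => ℂ) 2 :=
      ∑ j ∈ S, lp.single (E := fun _ : ι => ℂ) 2 j ((w j : ℂ) ^ (-(δ * (z - 1))) * x j)
    have hv : v ∈ Metric.ball 0 R := by
      rw [mem_ball_zero_iff]
      refine (lp.norm_sum_single_mono ENNReal.ofNat_ne_top S fun j _ => ?_).trans_lt hx
      simp [hnorm, hz1]
    have hyv : ∀ j, y z j = ((w j ^ (-δ) : ℝ) : ℂ) * v j := fun j => by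
      simp only [y, v, lp.coeFn_sum, Finset.sum_apply, lp.coeFn_single, Finset.sum_pi_single]
      split_ifs
      · rw [hcpow, ← mul_assoc, ← Complex.cpow_add _ _ (hwc j)]
        congr 2
        push_cast
        ring
      · simp
    refine (lp.norm_sum_single_mono hP K fun k _ => ?_).trans (hGb v hv (y z) hyv K)
    rw [norm_mul, norm_mul, hcpow, hnorm, hnorm]
    simp [hz1]
  have key := Complex.HadamardThreeLines.norm_le_interp_of_mem_verticalClosedStrip' (z := lam)
    one_pos ⟨by simpa using hlam0, by simpa using hlam1⟩ hdiff hbdd hleft hright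
  simp only [Complex.ofReal_re, sub_zero, div_one] at key
  refine le_of_eq_of_le ?_ key
  simp only [g, y, hcpow]
  push_cast
  rfl

theorem norm_interpolation_le {ι : Type*} [DecidableEq ι]
    (hP : P ≠ ∞) {w : ι → ℝ} (hw : ∀ k, 1 ≤ w k)
    {δ γ R Ma Mb lam : ℝ} (hδ : 0 ≤ δ) (hγ : 0 ≤ γ) (hlam0 : 0 ≤ lam) (hlam1 : lam ≤ 1)
    {G : lp (fun _ : ι => ℂ) 2 → lp (fun _ : ι => ℂ) P}
    (hG : DifferentiableOn ℂ G (Metric.ball 0 R))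
    (hGa : ∀ y ∈ Metric.ball (0 : lp (fun _ : ι => ℂ) 2) R, ‖G y‖ ≤ Ma)
    (hGb : ∀ v ∈ Metric.ball (0 : lp (fun _ : ι => ℂ) 2) R, ∀ y : lp (fun _ : ι => ℂ) 2,
      (∀ j, y j = ((w j ^ (-δ) : ℝ) : ℂ) * v j) → ∀ K : Finset ι,
      ‖∑ k ∈ K, lp.single (E := fun _ : ι => ℂ) P k (((w k ^ γ : ℝ) : ℂ) * G y k)‖ ≤ Mb)
    {v y : lp (fun _ : ι => ℂ) 2} (hv : v ∈ Metric.ball 0 R) (hyR : y ∈ Metric.ball 0 R)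
    (hy : ∀ j, y j = ((w j ^ (-(δ * lam)) : ℝ) : ℂ) * v j) (K : Finset ι) :
    ‖∑ k ∈ K, lp.single (E := fun _ : ι => ℂ) P k (((w k ^ (γ * lam) : ℝ) : ℂ) * G y k)‖ ≤
      Ma ^ (1 - lam) * Mb ^ lam := by
  have hlim : Filter.Tendsto (fun S => G (∑ j ∈ S, lp.single (E := fun _ : ι => ℂ) 2 j (y j)))
      Filter.atTop (nhds (G y)) :=
    (hG.differentiableAt (Metric.isOpen_ball.mem_nhds hyR)).continuousAt.tendsto.comp
      (lp.hasSum_single ENNReal.ofNat_ne_top y)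
  have hcont : Continuous fun u : lp (fun _ : ι => ℂ) P =>
      ‖∑ k ∈ K, lp.single (E := fun _ : ι => ℂ) P k (((w k ^ (γ * lam) : ℝ) : ℂ) * u k)‖ := by
    refine (continuous_finsetSum K fun k _ => ?_).norm
    exact (lp.isometry_single k).continuous.comp
      (continuous_const.mul (lp.evalCLM ℂ (fun _ : ι => ℂ) P k).continuous)
  refine le_of_tendsto ((hcont.tendsto _).comp hlim) (Filter.Eventually.of_forall fun S => ?_)
  have := norm_interpolation_le_of_finite hP hw hδ hγ hlam0 hlam1 hG hGa hGb v S K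
    ((lp.norm_sum_single_le ENNReal.ofNat_ne_top v S).trans_lt (mem_ball_zero_iff.1 hv))
  simpa only [Function.comp_apply, hy] using this

end Interpolation

section WeightedSpaces

theorem one_le_wt (k : ℤ) : 1 ≤ wt k := by simp [wt]

theorem wt_pos (k : ℤ) : 0 < wt k := one_pos.trans_le (one_le_wt k)

theorem norm_wt_rpow_mul (k : ℤ) (t : ℝ) (z : ℂ) :
    ‖((wt k ^ t : ℝ) : ℂ) * z‖ = wt k ^ t * ‖z‖ := by
  rw [norm_mul, Complex.norm_of_nonneg (Real.rpow_nonneg (wt_pos k).le t)]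

theorem wt_rpow_mul_rpow_mul (k : ℤ) {r s t : ℝ} (h : r + s = t) (z : ℂ) :
    ((wt k ^ r : ℝ) : ℂ) * (((wt k ^ s : ℝ) : ℂ) * z) = ((wt k ^ t : ℝ) : ℂ) * z := by
  rw [← h, Real.rpow_add (wt_pos k)]
  push_cast
  ring

variable {P : ℝ≥0∞} [Fact (1 ≤ P)]

theorem memL_and_lNorm_eq (hP : P ≠ ∞) {t : ℝ} {ξ : ℤ → ℂ} (f : lp (fun _ : ℤ => ℂ) P)
    (hf : ∀ k, f k = ((wt k ^ t : ℝ) : ℂ) * ξ k) :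
    memL P.toReal t ξ ∧ lNorm P.toReal t ξ = ‖f‖ := by
  have hp := ENNReal.toReal_pos_of_fact hP
  have h : ∀ k, wt k ^ t * ‖ξ k‖ = ‖f k‖ := fun k => by rw [hf, norm_wt_rpow_mul]
  refine ⟨?_, ?_⟩
  · simpa only [memL, h] using (lp.memℓp f).summable hp
  · simp only [lNorm, h, lp.norm_eq_tsum_rpow hp]

theorem memL.exists_lp (hP : P ≠ ∞) {t : ℝ} {ξ : ℤ → ℂ} (h : memL P.toReal t ξ) :
    ∃ f : lp (fun _ : ℤ => ℂ) P, ∀ k, f k = ((wt k ^ t : ℝ) : ℂ) * ξ k :=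
  ⟨⟨fun k => ((wt k ^ t : ℝ) : ℂ) * ξ k, (memℓp_gen_iff (ENNReal.toReal_pos_of_fact hP)).2
    (by simpa only [norm_wt_rpow_mul, memL] using h)⟩, fun _ => rfl⟩

theorem memH_iff_memL {s : ℝ} {φ : ℤ → ℂ} : memH s φ ↔ memL (2 : ℝ≥0∞).toReal s φ := by
  simp [memH, memL]

theorem hNorm_eq_lNorm (s : ℝ) (φ : ℤ → ℂ) : hNorm s φ = lNorm (2 : ℝ≥0∞).toReal s φ := by
  simp [hNorm, lNorm]

theorem memH_and_hNorm_eq (s : ℝ) (v : lp (fun _ : ℤ => ℂ) 2) :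
    memH s (fun j => ((wt j ^ (-s) : ℝ) : ℂ) * v j) ∧
      hNorm s (fun j => ((wt j ^ (-s) : ℝ) : ℂ) * v j) = ‖v‖ := by
  rw [memH_iff_memL, hNorm_eq_lNorm]
  refine memL_and_lNorm_eq ENNReal.ofNat_ne_top v fun k => ?_
  rw [wt_rpow_mul_rpow_mul k (add_neg_cancel s)]
  simp

theorem memH.exists_lp {s : ℝ} {φ : ℤ → ℂ} (h : memH s φ) :
    ∃ v : lp (fun _ : ℤ => ℂ) 2, (fun j => ((wt j ^ (-s) : ℝ) : ℂ) * v j) = φ := by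
  obtain ⟨v, hv⟩ := (memH_iff_memL.1 h).exists_lp ENNReal.ofNat_ne_top
  refine ⟨v, funext fun j => ?_⟩
  rw [hv, wt_rpow_mul_rpow_mul j (neg_add_cancel s)]
  simp

end WeightedSpaces

/-- **Nonlinear interpolation (Theorem 1.1).** Let `b > a ≥ 0`, `α ≥ 0`, `β > 0`, `R > 0`,
`1 ≤ p < ∞`, `M_a, M_b > 0`. If `F : B^a_ℂ(R) → ℓ^{p,α+βa}_ℂ` is analytic and bounded by `M_a`,
and `sup_{φ ∈ B^b_ℂ(R)} ‖F φ‖_{p,α+βb} ≤ M_b`, then for every `λ ∈ [0,1]` and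
`s = (1−λ)a + λb`, `F` maps `B^s_ℂ(R)` into `ℓ^{p,α+βs}_ℂ`, is bounded there by
`M_a^{1−λ} M_b^λ`, and `F|_{B^s_ℂ(R)} : B^s_ℂ(R) → ℓ^{p,α+βs}_ℂ` is analytic. -/
theorem nonlinear_interpolation
    (a b α β R Ma Mb : ℝ) (ha : 0 ≤ a) (hab : a < b) (hα : 0 ≤ α) (hβ : 0 < β)
    (hR : 0 < R) (hMa : 0 < Ma) (hMb : 0 < Mb)
    (P : ℝ≥0∞) [Fact (1 ≤ P)] (hP : P ≠ ∞)
    (F : (ℤ → ℂ) → (ℤ → ℂ))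
    -- `F : B^a_ℂ(R) → ℓ^{p,α+βa}_ℂ` is bounded by `M_a` :
    (hFa_bdd : ∀ φ : ℤ → ℂ, memH a φ → hNorm a φ < R →
      memL P.toReal (α + β * a) (F φ) ∧ lNorm P.toReal (α + β * a) (F φ) ≤ Ma)
    -- `F : B^a_ℂ(R) → ℓ^{p,α+βa}_ℂ` is analytic :
    (hFa_an : IsAnalyticOnBall P a (α + β * a) R F)
    -- `sup_{φ ∈ B^b_ℂ(R)} ‖F(φ)‖_{p,α+βb} ≤ M_b` :
    (hFb_bdd : ∀ φ : ℤ → ℂ, memH b φ → hNorm b φ < R →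
      memL P.toReal (α + β * b) (F φ) ∧ lNorm P.toReal (α + β * b) (F φ) ≤ Mb)
    (lam s : ℝ) (hlam0 : 0 ≤ lam) (hlam1 : lam ≤ 1)
    (hs : s = (1 - lam) * a + lam * b) :
    (∀ φ : ℤ → ℂ, memH s φ → hNorm s φ < R →
      memL P.toReal (α + β * s) (F φ) ∧
      lNorm P.toReal (α + β * s) (F φ) ≤ Ma ^ (1 - lam) * Mb ^ lam) ∧
    IsAnalyticOnBall P s (α + β * s) R F := by
  obtain ⟨G, hG, hGF⟩ := hFa_an
  have hδ : 0 ≤ b - a := (sub_pos.2 hab).le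
  have hγ : 0 ≤ β * (b - a) := mul_nonneg hβ.le hδ
  have hGa : ∀ y ∈ Metric.ball (0 : lp (fun _ : ℤ => ℂ) 2) R, ‖G y‖ ≤ Ma := fun y hy => by
    obtain ⟨hm, hn⟩ := memH_and_hNorm_eq a y
    rw [← (memL_and_lNorm_eq hP (G y) (hGF y hy)).2]
    exact (hFa_bdd _ hm (hn.trans_lt (mem_ball_zero_iff.1 hy))).2
  have hball : ∀ t : ℝ, 0 ≤ t → ∀ v y : lp (fun _ : ℤ => ℂ) 2, v ∈ Metric.ball 0 R →
      (∀ j, y j = ((wt j ^ (-t) : ℝ) : ℂ) * v j) → y ∈ Metric.ball 0 R := by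
    intro t ht v y hv hy
    rw [mem_ball_zero_iff] at hv ⊢
    refine (lp.norm_mono two_ne_zero fun j => ?_).trans_lt hv
    rw [hy, norm_wt_rpow_mul]
    exact mul_le_of_le_one_left (norm_nonneg _)
      (Real.rpow_le_one_of_one_le_of_nonpos (one_le_wt j) (neg_nonpos.2 ht))
  have hGb : ∀ v ∈ Metric.ball (0 : lp (fun _ : ℤ => ℂ) 2) R, ∀ y : lp (fun _ : ℤ => ℂ) 2,
      (∀ j, y j = ((wt j ^ (-(b - a)) : ℝ) : ℂ) * v j) → ∀ K : Finset ℤ,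
      ‖∑ k ∈ K, lp.single (E := fun _ : ℤ => ℂ) P k
        (((wt k ^ (β * (b - a)) : ℝ) : ℂ) * G y k)‖ ≤ Mb := by
    intro v hv y hy K
    obtain ⟨hm, hn⟩ := memH_and_hNorm_eq b v
    obtain ⟨hL, hLn⟩ := hFb_bdd _ hm (hn.trans_lt (mem_ball_zero_iff.1 hv))
    obtain ⟨f, hf⟩ := hL.exists_lp hP
    rw [(memL_and_lNorm_eq hP f hf).2] at hLn
    refine le_trans (le_of_eq ?_) ((lp.norm_sum_single_le hP f K).trans hLn)
    have hφ : (fun j => ((wt j ^ (-a) : ℝ) : ℂ) * y j) =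
        fun j => ((wt j ^ (-b) : ℝ) : ℂ) * v j := funext fun j => by
      rw [hy, wt_rpow_mul_rpow_mul j (t := -b) (by ring)]
    congr 1
    refine Finset.sum_congr rfl fun k _ => ?_
    rw [hGF y (hball _ hδ v y hv hy), hf, hφ,
      wt_rpow_mul_rpow_mul k (t := α + β * b) (by ring)]
  have hlδ : 0 ≤ (b - a) * lam := mul_nonneg hδ hlam0
  obtain ⟨D, hD, -⟩ := lp.exists_diagonal (P := 2)
    (fun j : ℤ => ((wt j ^ (-((b - a) * lam)) : ℝ) : ℂ))
    fun j => by
      rw [Complex.norm_of_nonneg (Real.rpow_nonneg (wt_pos j).le _)]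
      exact Real.rpow_le_one_of_one_le_of_nonpos (one_le_wt j) (neg_nonpos.2 hlδ)
  have hDR : ∀ v ∈ Metric.ball (0 : lp (fun _ : ℤ => ℂ) 2) R, D v ∈ Metric.ball 0 R := fun v hv =>
    hball _ hlδ v (D v) hv (hD v)
  have hDφ : ∀ v : lp (fun _ : ℤ => ℂ) 2, (fun j => ((wt j ^ (-a) : ℝ) : ℂ) * D v j) =
      fun j => ((wt j ^ (-s) : ℝ) : ℂ) * v j := fun v => funext fun j => by
    rw [hD, wt_rpow_mul_rpow_mul j (t := -s) (by rw [hs]; ring)]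
  have hex : ∀ v ∈ Metric.ball (0 : lp (fun _ : ℤ => ℂ) 2) R, ∃ f : lp (fun _ : ℤ => ℂ) P,
      (∀ k, f k = ((wt k ^ (β * (b - a) * lam) : ℝ) : ℂ) * G (D v) k) ∧
      ‖f‖ ≤ Ma ^ (1 - lam) * Mb ^ lam := fun v hv =>
    lp.exists_of_norm_sum_single_le hP fun K =>
      norm_interpolation_le hP one_le_wt hδ hγ hlam0 hlam1 hG hGa hGb hv (hDR v hv) (hD v) K
  choose! Gs hGs hGsn using hex
  have hGsF : ∀ v ∈ Metric.ball (0 : lp (fun _ : ℤ => ℂ) 2) R, ∀ k,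
      Gs v k = ((wt k ^ (α + β * s) : ℝ) : ℂ) *
        F (fun j => ((wt j ^ (-s) : ℝ) : ℂ) * v j) k := fun v hv k => by
    rw [hGs v hv, hGF _ (hDR v hv), hDφ,
      wt_rpow_mul_rpow_mul k (t := α + β * s) (by rw [hs]; ring)]
  refine ⟨fun φ hφ hφR => ?_, Gs, ?_, hGsF⟩
  · obtain ⟨v, rfl⟩ := hφ.exists_lp
    rw [(memH_and_hNorm_eq s v).2, ← mem_ball_zero_iff] at hφR
    obtain ⟨hm, hn⟩ := memL_and_lNorm_eq hP (Gs v) (hGsF v hφR)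
    exact ⟨hm, hn.trans_le (hGsn v hφR)⟩
  · refine differentiableOn_lp_of_apply hP Metric.isOpen_ball hGsn fun k => ?_
    refine DifferentiableOn.congr (DifferentiableOn.const_mul ?_ _) fun v hv => hGs v hv k
    exact (lp.evalCLM ℂ (fun _ : ℤ => ℂ) P k).differentiable.comp_differentiableOn
      (hG.comp D.differentiable.differentiableOn hDR)
end

section
/- Let N be a nonnegative integer, R > 0, n₀ a positive integer, N < s < N+1 and λ = s − N. For each integer n > n₀ let g_n : B^0_ℂ(R) → ℂ be analytic, and suppose there are constants M_N, M_{N+1} > 0 such that ∑_{n>n₀} n^{2(N+1)} |g_n(q)|² ≤ M_N² for all q ∈ B^N_ℂ(R) and ∑_{n>n₀} n^{2(N+2)} |g_n(q)|² ≤ M_{N+1}² for all q ∈ B^{N+1}_ℂ(R). Then ∑_{n>n₀} n^{2(s+1)} |g_n(q)|² ≤ ((M_N)^{1−λ}(M_{N+1})^{λ})² for all q ∈ B^s_ℂ(R). -/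
open scoped ENNReal

open Complex.HadamardThreeLines in
/-- Three lines theorem for finite families of holomorphic functions, in the `ℓ²` norm. -/
theorem sum_norm_sq_le_interp_of_mem_verticalClosedStrip {ι : Type*} [Fintype ι]
    {f : ι → ℂ → ℂ} {A B : ℝ} {z : ℂ}
    (hd : ∀ i, DifferentiableOn ℂ (f i) (verticalClosedStrip 0 1))
    (hC : ∀ i, ∃ C, ∀ w ∈ verticalClosedStrip 0 1, ‖f i w‖ ≤ C)
    (hA : 0 ≤ A) (hB : 0 ≤ B)
    (ha : ∀ w : ℂ, w.re = 0 → ∑ i, ‖f i w‖ ^ 2 ≤ A ^ 2)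
    (hb : ∀ w : ℂ, w.re = 1 → ∑ i, ‖f i w‖ ^ 2 ≤ B ^ 2)
    (hz : z ∈ verticalClosedStrip 0 1) :
    ∑ i, ‖f i z‖ ^ 2 ≤ (A ^ (1 - z.re) * B ^ z.re) ^ 2 := by
  set G : ℂ → EuclideanSpace ℂ ι := fun w => WithLp.toLp 2 fun i => f i w
  have hG : ∀ w, ‖G w‖ ^ 2 = ∑ i, ‖f i w‖ ^ 2 := fun w => EuclideanSpace.norm_sq_eq _
  have hcl : closure (verticalStrip 0 1) ⊆ verticalClosedStrip 0 1 :=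
    closure_minimal (Set.preimage_mono Set.Ioo_subset_Icc_self)
      (isClosed_Icc.preimage Complex.continuous_re)
  have hGd : DifferentiableOn ℂ G (verticalClosedStrip 0 1) :=
    differentiableOn_euclidean.2 hd
  choose C hC using hC
  have hbdd : BddAbove ((norm ∘ G) '' verticalClosedStrip 0 1) := by
    refine ⟨√(∑ i, C i ^ 2), ?_⟩
    rintro _ ⟨w, hw, rfl⟩
    refine Real.le_sqrt_of_sq_le ?_
    rw [Function.comp_apply, hG]
    gcongr with i
    exact hC i w hw
  rw [← hG]
  gcongr
  exact norm_le_interp_of_mem_verticalClosedStrip₀₁' G hz (hGd.mono hcl).diffContOnCl hbdd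
    (fun w hw => le_of_sq_le_sq ((hG w).trans_le (ha w hw)) hA)
    (fun w hw => le_of_sq_le_sq ((hG w).trans_le (hb w hw)) hB)

/-- The truncation of the sequence `q` to the finite set `S`, multiplied by the sequence `c`. -/
noncomputable def truncMul (q : lp (fun _ : ℤ => ℂ) 2) (S : Finset ℤ) (c : ℤ → ℂ) :
    lp (fun _ : ℤ => ℂ) 2 :=
  ∑ k ∈ S, c k • lp.single 2 k ((q : ℤ → ℂ) k)

theorem truncMul_apply (q : lp (fun _ : ℤ => ℂ) 2) (S : Finset ℤ) (c : ℤ → ℂ) (j : ℤ) :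
    (truncMul q S c : ℤ → ℂ) j = if j ∈ S then c j * (q : ℤ → ℂ) j else 0 := by
  simp only [truncMul, lp.coeFn_sum, Finset.sum_apply, lp.coeFn_smul, Pi.smul_apply,
    lp.single_apply, Pi.single_apply, smul_eq_mul, mul_ite, mul_zero]
  simp

theorem norm_truncMul_apply_le (q : lp (fun _ : ℤ => ℂ) 2) (S : Finset ℤ) (c : ℤ → ℂ) (j : ℤ) :
    ‖(truncMul q S c : ℤ → ℂ) j‖ ≤ ‖c j‖ * ‖(q : ℤ → ℂ) j‖ := by
  rw [truncMul_apply]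
  split_ifs
  · exact (norm_mul _ _).le
  · rw [norm_zero]; positivity

theorem continuous_truncMul (q : lp (fun _ : ℤ => ℂ) 2) (S : Finset ℤ) :
    Continuous (truncMul q S) := by
  unfold truncMul
  fun_prop

/-- A sequence dominated by one in the open ball of radius `R` of a weighted `ℓ²` space lies in
the corresponding ball. -/
theorem summable_and_tsum_rpow_half_lt_of_le {ι : Type*} {u v : ι → ℝ} {R : ℝ}
    (hu : ∀ k, 0 ≤ u k) (huv : ∀ k, u k ≤ v k) (hv : Summable fun k => v k ^ 2)
    (hR : (∑' k, v k ^ 2) ^ ((1 : ℝ) / 2) < R) :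
    Summable (fun k => u k ^ 2) ∧ (∑' k, u k ^ 2) ^ ((1 : ℝ) / 2) < R := by
  have hle : ∀ k, u k ^ 2 ≤ v k ^ 2 := fun k => pow_le_pow_left₀ (hu k) (huv k) 2
  have hs : Summable fun k => u k ^ 2 := hv.of_nonneg_of_le (fun k => sq_nonneg _) hle
  refine ⟨hs, lt_of_le_of_lt ?_ hR⟩
  exact Real.rpow_le_rpow (tsum_nonneg fun k => sq_nonneg _) (hs.tsum_le_tsum hle hv)
    (by norm_num)

theorem mem_ball_of_norm_apply_le {x : lp (fun _ : ℤ => ℂ) 2} {v : ℤ → ℝ} {R : ℝ}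
    (hxv : ∀ k, ‖(x : ℤ → ℂ) k‖ ≤ v k) (hv : Summable fun k => v k ^ 2)
    (hR : (∑' k, v k ^ 2) ^ ((1 : ℝ) / 2) < R) : x ∈ Metric.ball 0 R := by
  rw [mem_ball_zero_iff, lp.norm_eq_tsum_rpow (by norm_num)]
  simpa using (summable_and_tsum_rpow_half_lt_of_le (fun k => norm_nonneg _) hxv hv hR).2

theorem norm_wt_cpow (k : ℤ) (z : ℂ) : ‖(wt k : ℂ) ^ z‖ = wt k ^ z.re :=
  Complex.norm_cpow_eq_rpow_re_of_pos (wt_pos k) z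

/-- On a strip, a function holomorphic on a ball of `ℓ²` is holomorphic and bounded along the
family obtained by multiplying a truncated sequence by complex powers of the weight. -/
theorem differentiableOn_and_bounded_comp_truncMul {f : lp (fun _ : ℤ => ℂ) 2 → ℂ} {R s t : ℝ}
    {q : lp (fun _ : ℤ => ℂ) 2} (S : Finset ℤ) (hts : t ≤ s)
    (hf : DifferentiableOn ℂ f (Metric.ball 0 R))
    (hs : Summable fun k : ℤ => (wt k ^ s * ‖(q : ℤ → ℂ) k‖) ^ 2)
    (hR : (∑' k : ℤ, (wt k ^ s * ‖(q : ℤ → ℂ) k‖) ^ 2) ^ ((1 : ℝ) / 2) < R) :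
    DifferentiableOn ℂ (fun z : ℂ => f (truncMul q S fun k => (wt k : ℂ) ^ ((t : ℂ) - z)))
        {z | 0 ≤ z.re} ∧
      ∃ C, ∀ z : ℂ, 0 ≤ z.re → ‖f (truncMul q S fun k => (wt k : ℂ) ^ ((t : ℂ) - z))‖ ≤ C := by
  set T : Set (ℤ → ℂ) := Set.univ.pi fun k => Metric.closedBall 0 (wt k ^ s)
  have hball : Set.MapsTo (truncMul q S) T (Metric.ball 0 R) := by
    intro c hc
    refine mem_ball_of_norm_apply_le (fun k => ?_) hs hR
    refine (norm_truncMul_apply_le q S c k).trans ?_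
    gcongr
    simpa using hc k (Set.mem_univ k)
  have hT : ∀ z : ℂ, 0 ≤ z.re → (fun k : ℤ => (wt k : ℂ) ^ ((t : ℂ) - z)) ∈ T := by
    intro z hz k _
    rw [mem_closedBall_zero_iff, norm_wt_cpow]
    refine Real.rpow_le_rpow_of_exponent_le (one_le_wt k) ?_
    simp only [Complex.sub_re, Complex.ofReal_re]
    linarith
  constructor
  · refine hf.comp (t := Metric.ball 0 R) ?_ fun z hz => hball (hT z hz)
    unfold truncMul
    refine Differentiable.differentiableOn (Differentiable.fun_sum fun k _ => ?_)
    refine Differentiable.smul_const ?_ _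
    intro z
    refine DifferentiableAt.const_cpow (by fun_prop) (Or.inl ?_)
    exact_mod_cast (wt_pos k).ne'
  · have hcomp : IsCompact T := isCompact_univ_pi fun k => isCompact_closedBall 0 _
    obtain ⟨C, hC⟩ := hcomp.exists_bound_of_continuousOn
      (hf.continuousOn.comp (continuous_truncMul q S).continuousOn hball)
    exact ⟨C, fun z hz => hC _ (hT z hz)⟩

/-- **Interpolation of the asymptotic estimates between integer Sobolev exponents.**
Let `N ∈ ℤ_{≥0}`, `R > 0`, `n₀ ∈ ℤ_{>0}`, `N < s < N+1`, `λ = s − N`. If each `g_n`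
(`n > n₀`) is analytic on the ball `B^0_ℂ(R)` of `H^0_ℂ = ℓ²(ℤ,ℂ)`, and
`∑_{n>n₀} n^{2(N+1)} |g_n(q)|² ≤ M_N²` on `B^N_ℂ(R)` while
`∑_{n>n₀} n^{2(N+2)} |g_n(q)|² ≤ M_{N+1}²` on `B^{N+1}_ℂ(R)`, then
`∑_{n>n₀} n^{2(s+1)} |g_n(q)|² ≤ (M_N^{1−λ} M_{N+1}^λ)²` on `B^s_ℂ(R)`. -/
theorem interpolation_of_estimates
    (N : ℕ) (R : ℝ) (hR : 0 < R) (n₀ : ℕ) (hn₀ : 0 < n₀)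
    (s lam MN MN1 : ℝ) (hsl : (N : ℝ) < s) (hsu : s < (N : ℝ) + 1) (hlam : lam = s - N)
    (hMN : 0 < MN) (hMN1 : 0 < MN1)
    (g : ℕ → lp (fun _ : ℤ => ℂ) 2 → ℂ)
    (hg_an : ∀ n : ℕ, n₀ < n → DifferentiableOn ℂ (g n) (Metric.ball 0 R))
    (hgN : ∀ q : lp (fun _ : ℤ => ℂ) 2,
      Summable (fun k : ℤ => (wt k ^ (N : ℝ) * ‖(q : ℤ → ℂ) k‖) ^ 2) →
      (∑' k : ℤ, (wt k ^ (N : ℝ) * ‖(q : ℤ → ℂ) k‖) ^ 2) ^ ((1:ℝ)/2) < R →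
      Summable (fun n : {n : ℕ // n₀ < n} =>
        ((n : ℕ) : ℝ) ^ (2 * ((N : ℝ) + 1)) * ‖g n q‖ ^ 2) ∧
      (∑' n : {n : ℕ // n₀ < n}, ((n : ℕ) : ℝ) ^ (2 * ((N : ℝ) + 1)) * ‖g n q‖ ^ 2)
        ≤ MN ^ 2)
    (hgN1 : ∀ q : lp (fun _ : ℤ => ℂ) 2,
      Summable (fun k : ℤ => (wt k ^ ((N : ℝ) + 1) * ‖(q : ℤ → ℂ) k‖) ^ 2) →
      (∑' k : ℤ, (wt k ^ ((N : ℝ) + 1) * ‖(q : ℤ → ℂ) k‖) ^ 2) ^ ((1:ℝ)/2) < R →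
      Summable (fun n : {n : ℕ // n₀ < n} =>
        ((n : ℕ) : ℝ) ^ (2 * ((N : ℝ) + 2)) * ‖g n q‖ ^ 2) ∧
      (∑' n : {n : ℕ // n₀ < n}, ((n : ℕ) : ℝ) ^ (2 * ((N : ℝ) + 2)) * ‖g n q‖ ^ 2)
        ≤ MN1 ^ 2) :
    ∀ q : lp (fun _ : ℤ => ℂ) 2,
      Summable (fun k : ℤ => (wt k ^ s * ‖(q : ℤ → ℂ) k‖) ^ 2) →
      (∑' k : ℤ, (wt k ^ s * ‖(q : ℤ → ℂ) k‖) ^ 2) ^ ((1:ℝ)/2) < R →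
      Summable (fun n : {n : ℕ // n₀ < n} =>
        ((n : ℕ) : ℝ) ^ (2 * (s + 1)) * ‖g n q‖ ^ 2) ∧
      (∑' n : {n : ℕ // n₀ < n}, ((n : ℕ) : ℝ) ^ (2 * (s + 1)) * ‖g n q‖ ^ 2)
        ≤ (MN ^ (1 - lam) * MN1 ^ lam) ^ 2 := by
  intro q hq hqR
  have hn_pos : ∀ n : {n : ℕ // n₀ < n}, 0 < (n : ℕ) := fun n => hn₀.trans n.2
  have hN0 : (0 : ℝ) ≤ N := N.cast_nonneg
  have htrunc : ∀ (F : Finset {n : ℕ // n₀ < n}) (S : Finset ℤ),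
      ∑ n ∈ F, ((n : ℕ) : ℝ) ^ (2 * (s + 1)) * ‖g n (truncMul q S 1)‖ ^ 2
        ≤ (MN ^ (1 - lam) * MN1 ^ lam) ^ 2 := by
    intro F S
    set Q : ℂ → lp (fun _ : ℤ => ℂ) 2 :=
      fun z => truncMul q S fun k => (wt k : ℂ) ^ ((lam : ℂ) - z) with hQ
    set f : F → ℂ → ℂ :=
      fun n z => ((n : ℕ) : ℂ) ^ ((N : ℂ) + 1 + z) * g n (Q z) with hf
    have hfn : ∀ (n : F) (z : ℂ), ‖f n z‖ ^ 2 =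
        (((n : {n : ℕ // n₀ < n}) : ℕ) : ℝ) ^ (2 * ((N : ℝ) + 1 + z.re)) * ‖g n (Q z)‖ ^ 2 := by
      intro n z
      rw [hf, norm_mul, mul_pow, Complex.norm_natCast_cpow_of_pos (hn_pos n),
        mul_comm (2 : ℝ), Real.rpow_mul (Nat.cast_nonneg _)]
      simp
    have hQz : ∀ (a : ℝ) (z : ℂ), a + lam - z.re = s →
        Summable (fun k : ℤ => (wt k ^ a * ‖(Q z : ℤ → ℂ) k‖) ^ 2) ∧
        (∑' k : ℤ, (wt k ^ a * ‖(Q z : ℤ → ℂ) k‖) ^ 2) ^ ((1 : ℝ) / 2) < R := by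
      intro a z haz
      refine summable_and_tsum_rpow_half_lt_of_le
        (fun k => mul_nonneg (Real.rpow_nonneg (wt_pos k).le _) (norm_nonneg _))
        (fun k => ?_) hq hqR
      have hle := norm_truncMul_apply_le q S (fun k => (wt k : ℂ) ^ ((lam : ℂ) - z)) k
      rw [norm_wt_cpow, Complex.sub_re, Complex.ofReal_re] at hle
      refine (mul_le_mul_of_nonneg_left hle (Real.rpow_nonneg (wt_pos k).le a)).trans_eq ?_
      rw [← mul_assoc, ← Real.rpow_add (wt_pos k), ← haz]
      ring_nf
    have hreg := fun n : F => differentiableOn_and_bounded_comp_truncMul (t := lam) S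
      (by linarith) (hg_an n (n : {n : ℕ // n₀ < n}).2) hq hqR
    have hthree := sum_norm_sq_le_interp_of_mem_verticalClosedStrip (f := f) (A := MN)
      (B := MN1) (z := (lam : ℂ)) ?_ ?_ hMN.le hMN1.le ?_ ?_ ?_
    · have hQlam : Q lam = truncMul q S 1 := by
        simp only [hQ, sub_self, Complex.cpow_zero]
        rfl
      simp only [hfn, hQlam, Complex.ofReal_re] at hthree
      rw [← Finset.sum_coe_sort]
      refine le_of_eq_of_le (Finset.sum_congr rfl fun n _ => ?_) hthree
      rw [hlam]
      ring_nf
    · intro n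
      refine DifferentiableOn.mul ?_ ((hreg n).1.mono fun z hz => hz.1)
      refine Differentiable.differentiableOn fun z => ?_
      refine DifferentiableAt.const_cpow (by fun_prop) (Or.inl ?_)
      exact_mod_cast (hn_pos n).ne'
    · intro n
      obtain ⟨C, hC⟩ := (hreg n).2
      refine ⟨(((n : {n : ℕ // n₀ < n}) : ℕ) : ℝ) ^ ((N : ℝ) + 1 + 1) * C, fun z hz => ?_⟩
      rw [hf, norm_mul, Complex.norm_natCast_cpow_of_pos (hn_pos n)]
      gcongr
      · exact_mod_cast hn_pos n
      · simpa using hz.2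
      · exact hC z hz.1
    · intro z hz
      obtain ⟨h1, h2⟩ := hQz N z (by rw [hz, hlam]; ring)
      obtain ⟨h3, h4⟩ := hgN _ h1 h2
      simp only [hfn, hz, add_zero]
      rw [Finset.sum_coe_sort F fun n =>
        ((n : ℕ) : ℝ) ^ (2 * ((N : ℝ) + 1)) * ‖g n (Q z)‖ ^ 2]
      exact (h3.sum_le_tsum F fun n _ => by positivity).trans h4
    · intro z hz
      obtain ⟨h1, h2⟩ := hQz (N + 1) z (by rw [hz, hlam]; ring)
      obtain ⟨h3, h4⟩ := hgN1 _ h1 h2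
      simp only [hfn, hz, add_assoc, one_add_one_eq_two]
      rw [Finset.sum_coe_sort F fun n =>
        ((n : ℕ) : ℝ) ^ (2 * ((N : ℝ) + 2)) * ‖g n (Q z)‖ ^ 2]
      exact (h3.sum_le_tsum F fun n _ => by positivity).trans h4
    · constructor <;> rw [Complex.ofReal_re] <;> linarith
  have hqball : q ∈ Metric.ball 0 R := by
    refine mem_ball_of_norm_apply_le (fun k => ?_) hq hqR
    exact le_mul_of_one_le_left (norm_nonneg _)
      (Real.one_le_rpow (one_le_wt k) (by linarith))
  have hlim : Filter.Tendsto (fun S : Finset ℤ => truncMul q S 1) Filter.atTop (nhds q) := by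
    simpa [truncMul, HasSum] using lp.hasSum_single (by simp) q
  have hsum : ∀ F : Finset {n : ℕ // n₀ < n},
      ∑ n ∈ F, ((n : ℕ) : ℝ) ^ (2 * (s + 1)) * ‖g n q‖ ^ 2
        ≤ (MN ^ (1 - lam) * MN1 ^ lam) ^ 2 := by
    intro F
    refine le_of_tendsto (x := Filter.atTop) (tendsto_finsetSum F fun n _ => ?_)
      (Filter.Eventually.of_forall (htrunc F))
    have hcont := ((hg_an n n.2).continuousOn.continuousAt
      (Metric.isOpen_ball.mem_nhds hqball)).tendsto
    exact (((hcont.comp hlim).norm).pow 2).const_mul _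
  have hnonneg : 0 ≤ fun n : {n : ℕ // n₀ < n} =>
      ((n : ℕ) : ℝ) ^ (2 * (s + 1)) * ‖g n q‖ ^ 2 := fun n => by positivity
  exact ⟨summable_of_sum_le hnonneg hsum, Real.tsum_le_of_sum_le hnonneg hsum⟩
end

section
/- Let 0 ≤ a < b, s ∈ [a,b], and let φ ∈ H^s_ℂ. Then the map z ↦ φ_z, which sends z to the element of H^a_ℂ with Fourier coefficients (⟨k⟩^{s−z} φ̂(k))_{k∈ℤ}, is analytic (holomorphic) from the open strip S_{a,b} = {z = u+iv : v ∈ ℝ, a < u < b} into H^a_ℂ. -/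
open scoped ENNReal

/-- A map into `ℓᵖ` with holomorphic coordinates dominated, uniformly on an open set, by a fixed
element of `ℓᵖ` is holomorphic there. -/
theorem lp.differentiableOn_of_dominated {ι F : Type*} [NormedAddCommGroup F] [NormedSpace ℂ F]
    [CompleteSpace F] {p : ℝ≥0∞} [Fact (1 ≤ p)] (hp : p ≠ ⊤) {U : Set ℂ} (hU : IsOpen U)
    {G : ℂ → lp (fun _ : ι => F) p} (f : lp (fun _ : ι => F) p)
    (hG : ∀ i, DifferentiableOn ℂ (fun z => G z i) U) (hGf : ∀ z ∈ U, ∀ i, ‖G z i‖ ≤ ‖f i‖) :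
    DifferentiableOn ℂ G U := by
  classical
  have hp0 : p ≠ 0 := (zero_lt_one.trans_le Fact.out).ne'
  have hlim : TendstoUniformlyOn
      (fun (t : Finset ι) z => ∑ i ∈ t, lp.single p i (G z i)) G Filter.atTop U := by
    rw [Metric.tendstoUniformlyOn_iff]
    intro ε hε
    filter_upwards [Metric.tendsto_nhds.1 (lp.hasSum_single hp f) ε hε] with t ht z hz
    rw [dist_comm, dist_eq_norm] at ht
    rw [dist_eq_norm]
    refine (lp.norm_mono hp0 fun i => ?_).trans_lt ht
    simp only [lp.coeFn_sub, lp.coeFn_sum, lp.coeFn_single, Pi.sub_apply, Finset.sum_apply,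
      Finset.sum_pi_single]
    split_ifs
    · simp
    · simpa using hGf z hz i
  refine hlim.tendstoLocallyUniformlyOn.differentiableOn
    (Filter.Eventually.of_forall fun t => ?_) hU
  exact DifferentiableOn.fun_sum fun i _ =>
    (lp.singleContinuousLinearMap ℂ (fun _ : ι => F) p i).differentiable.comp_differentiableOn (hG i)

theorem norm_wt_rpow_mul_cpow_le {a s : ℝ} {z : ℂ} (hz : a ≤ z.re) (k : ℤ) (c : ℂ) :
    ‖((wt k ^ a : ℝ) : ℂ) * ((wt k : ℂ) ^ ((s : ℂ) - z) * c)‖ ≤ wt k ^ s * ‖c‖ := by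
  have hpos := wt_pos k
  rw [norm_mul, norm_mul, Complex.norm_real, Real.norm_of_nonneg (by positivity),
    Complex.norm_cpow_eq_rpow_re_of_pos hpos, ← mul_assoc, ← Real.rpow_add hpos]
  gcongr
  · exact one_le_wt k
  · simp only [Complex.sub_re, Complex.ofReal_re]
    linarith

/-- **Analyticity of the deformed family.** Let `0 ≤ a < b`, `s ∈ [a,b]` and `φ ∈ H^s_ℂ`.
Then the map `z ↦ φ_z`, sending `z` to the element of `H^a_ℂ` with Fourier coefficients
`(⟨k⟩^{s−z} φ̂(k))_k`, is analytic (holomorphic) from the open strip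
`S_{a,b} = {z = u+iv : a < u < b}` into `H^a_ℂ`. Here `H^a_ℂ` is identified isometrically
with `ℓ² = lp (fun _ : ℤ => ℂ) 2` via `ψ ↦ (⟨k⟩^a ψ̂(k))_k`, so the claim is that there is
a map `G` into `ℓ²`, complex differentiable on the strip, whose coefficients on the strip
are `⟨k⟩^a ⟨k⟩^{s−z} φ̂(k)`. -/
theorem deformed_family_analytic (a b s : ℝ) (ha : 0 ≤ a) (hab : a < b)
    (has : a ≤ s) (hsb : s ≤ b)
    (φ : ℤ → ℂ) (hφ : Summable fun k : ℤ => (wt k ^ s * ‖φ k‖) ^ 2) :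
    ∃ G : ℂ → lp (fun _ : ℤ => ℂ) 2,
      DifferentiableOn ℂ G {z : ℂ | a < z.re ∧ z.re < b} ∧
      ∀ z ∈ {z : ℂ | a < z.re ∧ z.re < b}, ∀ k : ℤ,
        (G z : ℤ → ℂ) k = ((wt k ^ a : ℝ) : ℂ) * ((wt k : ℂ) ^ ((s : ℂ) - z) * φ k) := by
  have hf : Memℓp (fun k : ℤ => ((wt k ^ s : ℝ) : ℂ) * φ k) 2 := by
    refine memℓp_gen (hφ.congr fun k => ?_)
    have := wt_pos k
    rw [norm_mul, Complex.norm_real, Real.norm_of_nonneg (by positivity)]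
    simp
  have hbound {z : ℂ} (hz : a ≤ z.re) (k : ℤ) :
      ‖((wt k ^ a : ℝ) : ℂ) * ((wt k : ℂ) ^ ((s : ℂ) - z) * φ k)‖ ≤
        ‖((wt k ^ s : ℝ) : ℂ) * φ k‖ := by
    have := wt_pos k
    rw [norm_mul ((wt k ^ s : ℝ) : ℂ), Complex.norm_real, Real.norm_of_nonneg (by positivity)]
    exact norm_wt_rpow_mul_cpow_le hz k (φ k)
  have hex (z : ℂ) : ∃ g : lp (fun _ : ℤ => ℂ) 2, a ≤ z.re → ∀ k : ℤ,
      g k = ((wt k ^ a : ℝ) : ℂ) * ((wt k : ℂ) ^ ((s : ℂ) - z) * φ k) := by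
    by_cases hz : a ≤ z.re
    · exact ⟨⟨_, hf.mono' (hbound hz)⟩, fun _ _ => rfl⟩
    · exact ⟨0, fun h => absurd h hz⟩
  choose G hG using hex
  have hU : IsOpen {z : ℂ | a < z.re ∧ z.re < b} :=
    (isOpen_lt continuous_const Complex.continuous_re).inter
      (isOpen_lt Complex.continuous_re continuous_const)
  refine ⟨G, lp.differentiableOn_of_dominated (by simp) hU ⟨_, hf⟩ (fun k => ?_)
    fun z hz k => ?_, fun z hz => hG z hz.1.le⟩
  · refine DifferentiableOn.congr (Differentiable.differentiableOn fun z => ?_)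
      fun z hz => hG z hz.1.le k
    have hne : (wt k : ℂ) ≠ 0 := by exact_mod_cast (wt_pos k).ne'
    exact (((differentiableAt_const (s : ℂ)).sub differentiableAt_id).const_cpow
      (Or.inl hne)).mul_const _ |>.const_mul _
  · rw [hG z hz.1.le k]
    exact hbound hz.1.le k
end
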